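/- arXiv:2603.29714 — 4 statements merged into one kernel-verified Lean document; each statement's English description precedes it below -/
import Mathlib

section
/- Let x ∈ P have rank r ≥ 1 with {i : y_i ≤ x} = {1,…,r}. For a subset U ⊆ {1,…,r} with #U ≥ 2, write [U] for the set of minimal elements among the common upper bounds of {y_i : i ∈ U}. Then the element f_U := ∑_{z ∈ [U]} t̃_z of S lies in the ideal I_P. -/
open scoped Classical
open MvPolynomial

noncomputable section

variable (K : Type) [Field K]
variable (P : Type) [Fintype P] [PartialOrder P] [OrderBot P]

/-- A finite poset with a least element is *simplicial* if every lower interval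
is isomorphic to a boolean algebra (the lattice of all subsets of a finite set). -/
def IsSimplicialPoset : Prop :=
  ∀ x : P, ∃ m : ℕ, Nonempty (Set.Iic x ≃o Finset (Fin m))

/-- `P* := P \ {0̂}`. -/
abbrev Pstar := {z : P // z ≠ ⊥}

/-- The polynomial ring `S = K[t_z : z ∈ P*]`. -/
abbrev FaceS := MvPolynomial (Pstar P) K

/-- The variable `t_z`, with the convention `t_{0̂} = 1`. -/
def tvar (z : P) : FaceS K P := if h : z = ⊥ then 1 else X ⟨z, h⟩

/-- The set `[a ∨ b]` of minimal elements of the common upper bounds of `a` and `b`. -/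
def minUB (a b : P) : Set P :=
  {z | a ≤ z ∧ b ≤ z ∧ ∀ w, a ≤ w → b ≤ w → ¬ w < z}

/-- Minimal elements of the common upper bounds of a set `A`. -/
def minUBset (A : Set P) : Set P :=
  {z | (∀ a ∈ A, a ≤ z) ∧ ∀ w, (∀ a ∈ A, a ≤ w) → ¬ w < z}

/-- The meet `a ∧ b`, i.e. the largest common lower bound, when it exists (`⊥` otherwise). -/
def pmeet (a b : P) : P :=
  if h : ∃ m, m ≤ a ∧ m ≤ b ∧ ∀ w, w ≤ a → w ≤ b → w ≤ m then h.choose else ⊥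

/-- The generator `f_{a,b} = t_a t_b - t_{a ∧ b} ∑_{z ∈ [a ∨ b]} t_z` of the face ideal. -/
def fgen (a b : Pstar P) : FaceS K P :=
  X a * X b - tvar K P (pmeet P a.1 b.1) *
    ∑ z ∈ (Set.toFinite (minUB P a.1 b.1)).toFinset, tvar K P z

/-- The face ideal `I_P`. -/
def faceIdeal : Ideal (FaceS K P) :=
  Ideal.span (Set.range fun p : Pstar P × Pstar P => fgen K P p.1 p.2)

variable (n : ℕ) (y : Fin n → P)

/-- `y` is an enumeration of the rank one elements (= atoms) of `P`. -/
def AtomEnum : Prop :=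
  Function.Injective y ∧ ∀ p : P, IsAtom p ↔ ∃ i, y i = p

/-- The rank of an element: the number of atoms below it. -/
def prank (z : P) : ℕ := (Finset.univ.filter fun i : Fin n => y i ≤ z).card

/-- The `ℤⁿ`-degree of the variable `t_z`: `deg t_z = ∑_{y_i ≤ z} e_i`. -/
def tdeg (z : Pstar P) : Fin n → ℤ := fun i => if y i ≤ z.1 then 1 else 0

/-- `w = ∑_{z ∈ P*} deg t_z`. -/
def wvec : Fin n → ℤ := fun i => ∑ z : Pstar P, tdeg P n y z i

/-- The degree `d` homogeneous component of `S` for the `ℤⁿ`-grading. -/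
def Sgrade (d : Fin n → ℤ) : AddSubgroup (FaceS K P) :=
  (weightedHomogeneousSubmodule K (tdeg P n y) d).toAddSubgroup

/-- The transformed variable `t̃_z` (relative to `x`), with `t̃_{0̂} = 1`. -/
def ttil (x z : P) : FaceS K P :=
  if z ≤ x ∧ 2 ≤ prank P n y z then
    tvar K P z - ∏ i ∈ Finset.univ.filter fun i : Fin n => y i ≤ z, tvar K P (y i)
  else tvar K P z

/-- The graded prime ideal `p_x = (t_z : z ≰ x) + I_P`. -/
def pIdeal (x : P) : Ideal (FaceS K P) :=
  Ideal.span ((fun z : Pstar P => (X z : FaceS K P)) '' {z | ¬ z.1 ≤ x}) ⊔ faceIdeal K P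

/-- The indices of the atoms below `x`. -/
abbrev BelowIx (x : P) := {i : Fin n // y i ≤ x}

/-- `P*_{-x}`: the elements of `P*` which are not atoms below `x`. -/
abbrev Pmx (x : P) := {z : P // z ≠ ⊥ ∧ ¬ ∃ i : Fin n, y i ≤ x ∧ y i = z}

/-- Index monoid for the "big Laurent" model of `*E_x`. -/
abbrev EIdx (x : P) := (BelowIx P n y x →₀ ℤ) × (Pmx P n y x →₀ ℤ)

/-- The "big Laurent" algebra `K[t_i^{±1} : y_i ≤ x] ⊗_K K[t̃_z^{±1} : z ∈ P*_{-x}]`. -/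
abbrev Gx (x : P) := AddMonoidAlgebra K (EIdx P n y x)

/-- Exponent vector of `π_x(t_z) = ∏_{y_i ≤ z} t_i`. -/
def dvec (x : P) (z : P) : BelowIx P n y x →₀ ℤ :=
  Finsupp.equivFunOnFinite.symm fun i => if y i.1 ≤ z then 1 else 0

/-- The action of `S` on the big Laurent algebra through the comultiplication
`Δ(t_z) = t_z ⊗ 1 + 1 ⊗ t_z`:  the variable `t_z` acts as `π_x(t_z) ⊗ 1 + 1 ⊗ t_z`. -/
def theta (x : P) : FaceS K P →ₐ[K] Gx K P n y x :=
  aeval fun z : Pstar P =>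
    (if z.1 ≤ x then AddMonoidAlgebra.single (dvec P n y x z.1, 0) 1 else 0) +
    (if h : ∃ i : Fin n, y i ≤ x ∧ y i = z.1 then 0
     else AddMonoidAlgebra.single
       ((0 : BelowIx P n y x →₀ ℤ), Finsupp.single (⟨z.1, z.2, h⟩ : Pmx P n y x) (1 : ℤ)) 1)

instance gxModule (x : P) : Module (FaceS K P) (Gx K P n y x) :=
  Module.compHom _ (theta K P n y x).toRingHom

instance gxTower (x : P) : IsScalarTower K (FaceS K P) (Gx K P n y x) := by
  refine ⟨fun k s g => ?_⟩
  show theta K P n y x (k • s) * g = k • (theta K P n y x s * g)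
  rw [map_smul, smul_mul_assoc]

instance gxComm (x : P) : SMulCommClass (FaceS K P) K (Gx K P n y x) := by
  refine ⟨fun s k g => ?_⟩
  show theta K P n y x s * (k • g) = k • (theta K P n y x s * g)
  exact mul_smul_comm k _ g

/-- The submodule by which we quotient the big Laurent algebra to obtain `*E_x`. -/
def Ux (x : P) : Submodule (FaceS K P) (Gx K P n y x) :=
  Submodule.span (FaceS K P)
    {g | ∃ p : EIdx P n y x, (∃ w, 0 < p.2 w) ∧ g = AddMonoidAlgebra.single p 1}

/-- The `ℤⁿ`-graded `S`-module `*E_x = K[t_i^{±1} : y_i ≤ x] ⊗_K K[t_z^{-1} : z ∈ P*_{-x}]`. -/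
abbrev ExMod (x : P) := Gx K P n y x ⧸ Ux K P n y x

instance exComm (x : P) : SMulCommClass (FaceS K P) K (ExMod K P n y x) := by
  refine ⟨fun s k e => ?_⟩
  obtain ⟨g, rfl⟩ := Submodule.Quotient.mk_surjective _ e
  simp only [← Submodule.Quotient.mk_smul]
  rw [smul_comm]

def mIdx (x : P) (a : BelowIx P n y x →₀ ℤ) (b : Pmx P n y x →₀ ℕ) : EIdx P n y x :=
  (a, -Finsupp.mapRange (Nat.cast : ℕ → ℤ) Nat.cast_zero b)

/-- The monomial `∏ t_i^{a_i} ⊗ ∏ t_z^{-b_z}` of `*E_x`. -/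
def emono (x : P) (a : BelowIx P n y x →₀ ℤ) (b : Pmx P n y x →₀ ℕ) : ExMod K P n y x :=
  Submodule.Quotient.mk (AddMonoidAlgebra.single (mIdx P n y x a b) 1)

/-- `1_x = 1 ⊗ 1 ∈ *E_x`. -/
def onex (x : P) : ExMod K P n y x := emono K P n y x 0 0

/-- The `ℤⁿ`-degree of the monomial of `*E_x` with index `p`. -/
def gdeg (x : P) (p : EIdx P n y x) : Fin n → ℤ := fun i =>
  (if h : y i ≤ x then p.1 ⟨i, h⟩ else 0) +
    p.2.sum fun w c => c * (if y i ≤ w.1 then 1 else 0)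

/-- The degree `aa` homogeneous component of `*E_x`. -/
def ExGrade (x : P) (aa : Fin n → ℤ) : Submodule K (ExMod K P n y x) :=
  Submodule.span K
    {e | ∃ p : EIdx P n y x, gdeg P n y x p = aa ∧
      e = Submodule.Quotient.mk (AddMonoidAlgebra.single p 1)}

/-- `L(*E_x)`: the span of the basis monomials with nontrivial second factor and
componentwise nonnegative `ℤⁿ`-degree. -/
def cleanL (x : P) : Submodule K (ExMod K P n y x) :=
  Submodule.span K
    {e | ∃ a b, b ≠ 0 ∧ (∀ i, 0 ≤ gdeg P n y x (mIdx P n y x a b) i) ∧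
      e = emono K P n y x a b}

/-- Degree preserving homomorphisms `*E_x → *E_z` (elements of `[*Hom(E_x, E_z)]_0`). -/
def DegZero (x z : P) (φ : ExMod K P n y x →ₗ[FaceS K P] ExMod K P n y z) : Prop :=
  ∀ aa, ∀ e ∈ ExGrade K P n y x aa, φ e ∈ ExGrade K P n y z aa

/-- Clean homomorphisms `*E_x → *E_z`. -/
def IsClean (x z : P) (φ : ExMod K P n y x →ₗ[FaceS K P] ExMod K P n y z) : Prop :=
  DegZero K P n y x z φ ∧ ∀ e ∈ cleanL K P n y x, φ e ∈ cleanL K P n y z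


section SimplicialPoset

variable {K P n y}

/-- Any two elements below a common element have a meet. -/
lemma IsSimplicialPoset.exists_meet (hP : IsSimplicialPoset P) {w z z' : P}
    (hz : z ≤ w) (hz' : z' ≤ w) :
    ∃ m, m ≤ z ∧ m ≤ z' ∧ ∀ a, a ≤ z → a ≤ z' → a ≤ m := by
  obtain ⟨m, ⟨e⟩⟩ := hP w
  refine ⟨(e.symm (e ⟨z, hz⟩ ⊓ e ⟨z', hz'⟩)).1, ?_, ?_, fun a ha ha' => ?_⟩
  · have h : e.symm (e ⟨z, hz⟩ ⊓ e ⟨z', hz'⟩) ≤ ⟨z, hz⟩ := by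
      rw [e.symm_apply_le]; exact inf_le_left
    exact h
  · have h : e.symm (e ⟨z, hz⟩ ⊓ e ⟨z', hz'⟩) ≤ ⟨z', hz'⟩ := by
      rw [e.symm_apply_le]; exact inf_le_right
    exact h
  · have h : (⟨a, ha.trans hz⟩ : Set.Iic w) ≤ e.symm (e ⟨z, hz⟩ ⊓ e ⟨z', hz'⟩) := by
      rw [e.le_symm_apply]
      exact le_inf (e.monotone ha) (e.monotone ha')
    exact h

/-- An atom `a ≤ z` has a complement in the interval below `z`: an element strictly below `z`
that lies above all other atoms of the interval. -/
lemma IsSimplicialPoset.exists_lt_of_isAtom (hP : IsSimplicialPoset P) {a z : P}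
    (ha : IsAtom a) (haz : a ≤ z) :
    ∃ c, c < z ∧ ∀ b, IsAtom b → b ≤ z → b ≠ a → b ≤ c := by
  obtain ⟨m, ⟨e⟩⟩ := hP z
  have bot_of : ∀ s : Finset (Fin m), (e.symm s).1 = ⊥ → s = ⊥ := fun s hs => by
    have h : e.symm s ≤ e.symm ⊥ := by
      change (e.symm s).1 ≤ _
      rw [hs]
      exact bot_le
    exact le_bot_iff.1 (e.symm.le_iff_le.1 h)
  refine ⟨(e.symm (e ⟨a, haz⟩)ᶜ).1, lt_of_le_of_ne (e.symm _).2 fun h => ?_,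
    fun b hb hbz hba => ?_⟩
  · have h1 : (⟨a, haz⟩ : Set.Iic z) ≤ e.symm (e ⟨a, haz⟩)ᶜ := by
      change a ≤ _
      rw [h]
      exact haz
    rw [e.le_symm_apply, le_compl_self] at h1
    exact ha.1 (le_bot_iff.1 ((e.le_iff_le (x := ⟨a, haz⟩) (y := ⟨⊥, bot_le⟩)).1
      (h1.le.trans bot_le)))
  · have h : (⟨b, hbz⟩ : Set.Iic z) ≤ e.symm (e ⟨a, haz⟩)ᶜ := by
      rw [e.le_symm_apply, le_compl_iff_disjoint_right]
      refine disjoint_iff_inf_le.2 (le_of_eq (bot_of _ ?_))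
      have h1 : e.symm (e ⟨b, hbz⟩ ⊓ e ⟨a, haz⟩) ≤ ⟨b, hbz⟩ := by
        rw [e.symm_apply_le]; exact inf_le_left
      have h2 : e.symm (e ⟨b, hbz⟩ ⊓ e ⟨a, haz⟩) ≤ ⟨a, haz⟩ := by
        rw [e.symm_apply_le]; exact inf_le_right
      rcases hb.le_iff.1 (show (e.symm (e ⟨b, hbz⟩ ⊓ e ⟨a, haz⟩)).1 ≤ b from h1) with h3 | h3
      · exact h3
      · refine absurd ((ha.le_iff.1 (?_ : b ≤ a)).resolve_left hb.1) hba
        exact h3 ▸ h2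
    exact h

lemma exists_minUBset_le (A : Set P) {w : P} (hw : ∀ a ∈ A, a ≤ w) :
    ∃ z ∈ minUBset P A, z ≤ w := by
  obtain ⟨z, hzw, hz⟩ := (Set.toFinite {v : P | ∀ a ∈ A, a ≤ v}).exists_le_minimal hw
  exact ⟨z, ⟨hz.1, fun v hv hlt => hlt.not_ge (hz.2 hv hlt.le)⟩, hzw⟩

lemma IsSimplicialPoset.minUBset_unique (hP : IsSimplicialPoset P) {A : Set P} {w z z' : P}
    (hz : z ∈ minUBset P A) (hz' : z' ∈ minUBset P A) (hzw : z ≤ w) (hzw' : z' ≤ w) :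
    z = z' := by
  obtain ⟨m, hm, hm', h⟩ := hP.exists_meet hzw hzw'
  have hub : ∀ a ∈ A, a ≤ m := fun a ha => h a (hz.1 a ha) (hz'.1 a ha)
  rw [← hm.eq_of_not_lt (hz.2 m hub), hm'.eq_of_not_lt (hz'.2 m hub)]

/-- A minimal upper bound of `A` and `a` is the same as a minimal upper bound of `a` and of some
minimal upper bound of `A`. -/
lemma IsSimplicialPoset.mem_minUBset_insert (hP : IsSimplicialPoset P) {A : Set P} {a w : P} :
    w ∈ minUBset P (insert a A) ↔ ∃ z ∈ minUBset P A, w ∈ minUB P a z := by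
  constructor
  · rintro ⟨hw, hmin⟩
    obtain ⟨z, hz, hzw⟩ := exists_minUBset_le A fun b hb => hw b (Set.mem_insert_of_mem _ hb)
    refine ⟨z, hz, hw a (Set.mem_insert _ _), hzw, fun v hav hzv => hmin v ?_⟩
    rintro b (rfl | hb)
    exacts [hav, (hz.1 b hb).trans hzv]
  · rintro ⟨z, hz, haw, hzw, hmin⟩
    refine ⟨?_, fun v hv hlt => ?_⟩
    · rintro b (rfl | hb)
      exacts [haw, (hz.1 b hb).trans hzw]
    · obtain ⟨z', hz', hzv⟩ := exists_minUBset_le A fun b hb => hv b (Set.mem_insert_of_mem _ hb)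
      obtain rfl := hP.minUBset_unique hz hz' hzw (hzv.trans hlt.le)
      exact hmin v (hv a (Set.mem_insert _ _)) hzv hlt

/-- The atoms below a minimal upper bound of a set of atoms are the members of that set. -/
lemma IsSimplicialPoset.atom_le_iff (hP : IsSimplicialPoset P) (hy : AtomEnum P n y)
    {U : Finset (Fin n)} {z : P} (hz : z ∈ minUBset P (y '' (U : Set (Fin n)))) (i : Fin n) :
    y i ≤ z ↔ i ∈ U := by
  refine ⟨fun hi => ?_, fun hi => hz.1 _ ⟨i, hi, rfl⟩⟩
  by_contra hiU
  obtain ⟨c, hc, h⟩ := hP.exists_lt_of_isAtom ((hy.2 _).2 ⟨i, rfl⟩) hi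
  refine hz.2 c ?_ hc
  rintro _ ⟨j, hj, rfl⟩
  refine h _ ((hy.2 _).2 ⟨j, rfl⟩) (hz.1 _ ⟨j, hj, rfl⟩) fun hji => hiU ?_
  exact hy.1 hji ▸ hj

/-- An atom times a variable `t_z` with `a ≰ z`, modulo the face ideal. -/
lemma tvar_mul_tvar_sub_mem {a z : P} (ha : IsAtom a) (haz : ¬ a ≤ z) :
    tvar K P a * tvar K P z - ∑ w ∈ (Set.toFinite (minUB P a z)).toFinset, tvar K P w
      ∈ faceIdeal K P := by
  by_cases hz : z = ⊥
  · subst hz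
    have h : (Set.toFinite (minUB P a ⊥)).toFinset = {a} := by
      ext w
      simp only [Set.Finite.mem_toFinset, Finset.mem_singleton, minUB, Set.mem_ofPred_eq]
      refine ⟨fun ⟨h, _, hmin⟩ => (h.eq_of_not_lt (hmin a le_rfl bot_le)).symm, ?_⟩
      rintro rfl
      exact ⟨le_rfl, bot_le, fun v hv _ => hv.not_gt⟩
    rw [h]
    simp [tvar]
  · have hm : pmeet P a z = ⊥ := by
      unfold pmeet
      split_ifs with h
      · obtain ⟨h1, h2, -⟩ := h.choose_spec
        exact (ha.le_iff.1 h1).resolve_right fun h3 => haz (h3 ▸ h2)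
      · rfl
    have h : fgen K P ⟨a, ha.1⟩ ⟨z, hz⟩ ∈ faceIdeal K P :=
      Ideal.subset_span ⟨(⟨a, ha.1⟩, ⟨z, hz⟩), rfl⟩
    simpa [fgen, hm, tvar, ha.1, hz] using h

/-- A squarefree product of atom variables is congruent, modulo the face ideal, to the sum of the
variables of the minimal upper bounds. -/
lemma prod_tvar_sub_sum_mem (hP : IsSimplicialPoset P) (hy : AtomEnum P n y)
    (U : Finset (Fin n)) :
    ∏ i ∈ U, tvar K P (y i) -
      ∑ z ∈ (Set.toFinite (minUBset P (y '' (U : Set (Fin n))))).toFinset, tvar K P z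
      ∈ faceIdeal K P := by
  induction U using Finset.induction_on with
  | empty =>
    have h : (Set.toFinite (minUBset P (y '' ((∅ : Finset (Fin n)) : Set (Fin n))))).toFinset
        = {⊥} := by
      ext w
      simp only [Set.Finite.mem_toFinset, Finset.mem_singleton, minUBset, Set.mem_ofPred_eq]
      refine ⟨fun h => ?_, ?_⟩
      · by_contra hw
        exact h.2 ⊥ (by simp) (bot_lt_iff_ne_bot.2 hw)
      · rintro rfl
        simp
    rw [h]
    simp [tvar]
  | insert i U hi ih =>
    have hunion : (Set.toFinite (minUBset P (y '' ((insert i U : Finset _) : Set _)))).toFinset =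
        (Set.toFinite (minUBset P (y '' (U : Set (Fin n))))).toFinset.biUnion
          fun z => (Set.toFinite (minUB P (y i) z)).toFinset := by
      ext w
      simp only [Finset.coe_insert, Set.image_insert_eq, Set.Finite.mem_toFinset,
        Finset.mem_biUnion, hP.mem_minUBset_insert]
    rw [Finset.prod_insert hi, hunion, Finset.sum_biUnion]
    · have hsum := Ideal.sum_mem (faceIdeal K P)
        (t := (Set.toFinite (minUBset P (y '' (U : Set (Fin n))))).toFinset)
        (f := fun z => tvar K P (y i) * tvar K P z -
          ∑ w ∈ (Set.toFinite (minUB P (y i) z)).toFinset, tvar K P w) fun z hz =>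
        tvar_mul_tvar_sub_mem ((hy.2 _).2 ⟨i, rfl⟩) fun h =>
          hi ((hP.atom_le_iff hy ((Set.Finite.mem_toFinset _).1 hz) i).1 h)
      rw [Finset.sum_sub_distrib, ← Finset.mul_sum] at hsum
      convert add_mem (Ideal.mul_mem_left _ (tvar K P (y i)) ih) hsum using 1
      ring
    · intro z hz z' hz' hne
      refine Finset.disjoint_left.2 fun w hw hw' => hne ?_
      simp only [Set.Finite.coe_toFinset, Set.Finite.mem_toFinset] at hz hz' hw hw'
      exact hP.minUBset_unique hz hz' hw.2.1 hw'.2.1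

end SimplicialPoset

/-- Lemma 2.6(1): for `U ⊆ {1,…,r}` with `#U ≥ 2`,
`f_U := ∑_{z ∈ [U]} t̃_z ∈ I_P`. -/
theorem statement0
    (hP : IsSimplicialPoset P) (hy : AtomEnum P n y)
    (x : P) (r : ℕ) (hr : 1 ≤ r)
    (hx : ∀ i : Fin n, y i ≤ x ↔ (i : ℕ) < r)
    (U : Finset (Fin n)) (hU : ∀ i ∈ U, (i : ℕ) < r) (hU2 : 2 ≤ U.card) :
    (∑ z ∈ (Set.toFinite (minUBset P (y '' (U : Set (Fin n))))).toFinset,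
        ttil K P n y x z) ∈ faceIdeal K P := by
  obtain ⟨z₀, hz₀, hz₀x⟩ := exists_minUBset_le (y '' (U : Set (Fin n))) (w := x) (by
    rintro _ ⟨i, hi, rfl⟩
    exact (hx i).2 (hU i hi))
  have httil : ∀ z ∈ (Set.toFinite (minUBset P (y '' (U : Set (Fin n))))).toFinset,
      ttil K P n y x z = tvar K P z - if z = z₀ then ∏ i ∈ U, tvar K P (y i) else 0 := by
    intro z hz
    rw [Set.Finite.mem_toFinset] at hz
    have hfilter : (Finset.univ.filter fun i : Fin n => y i ≤ z) = U := by
      ext i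
      simp [hP.atom_le_iff hy hz i]
    have hiff : z ≤ x ↔ z = z₀ :=
      ⟨fun h => hP.minUBset_unique hz hz₀ h hz₀x, fun h => h ▸ hz₀x⟩
    unfold ttil prank
    rw [hfilter, hiff]
    split_ifs <;> simp_all
  rw [Finset.sum_congr rfl httil, Finset.sum_sub_distrib, Finset.sum_ite_eq',
    if_pos ((Set.Finite.mem_toFinset _).2 hz₀), ← neg_sub]
  exact neg_mem (prod_tvar_sub_sum_mem hP hy U)

end
end

section
/- Let x ∈ P have rank r ≥ 1 with {i : y_i ≤ x} = {1,…,r}, let U ⊆ {1,…,r} with #U ≥ 2, and write [U] for the set of minimal elements among the common upper bounds of {y_i : i ∈ U}. If z_1, z_2 ∈ [U] are distinct with z_1 ≤ x (hence z_2 ≰ x), then g_{z_1,z_2} := t̃_{z_1} t̃_{z_2} + t̃_{z_2} · ∏_{i ∈ U} t̃_i lies in the ideal I_P. -/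
open scoped Classical
open MvPolynomial

noncomputable section

variable (K : Type) [Field K]
variable (P : Type) [Fintype P] [PartialOrder P] [OrderBot P]

variable (n : ℕ) (y : Fin n → P)

/-- Two minimal upper bounds of the same set with a common upper bound are equal. -/
theorem IsSimplicialPoset.eq_of_mem_minUBset_of_le {Q : Type} [PartialOrder Q] [OrderBot Q]
    [Fintype Q] (hQ : IsSimplicialPoset Q) {A : Set Q} {a b w : Q}
    (ha : a ∈ minUBset Q A) (hb : b ∈ minUBset Q A) (haw : a ≤ w) (hbw : b ≤ w) : a = b := by
  obtain ⟨m, ⟨e⟩⟩ := hQ w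
  let a' : Set.Iic w := ⟨a, haw⟩
  let b' : Set.Iic w := ⟨b, hbw⟩
  let c := e.symm (e a' ∩ e b')
  have hca : c ≤ a' := (e.symm_apply_le).2 Finset.inter_subset_left
  have hcb : c ≤ b' := (e.symm_apply_le).2 Finset.inter_subset_right
  have hc : ∀ v ∈ A, v ≤ c.1 := fun v hv => by
    have hva : (⟨v, (ha.1 v hv).trans haw⟩ : Set.Iic w) ≤ a' := ha.1 v hv
    have hvb : (⟨v, (ha.1 v hv).trans haw⟩ : Set.Iic w) ≤ b' := hb.1 v hv
    exact (e.le_symm_apply).2 (Finset.subset_inter (e.monotone hva) (e.monotone hvb))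
  have h₁ : c.1 = a := eq_of_le_of_not_lt hca (ha.2 _ hc)
  have h₂ : c.1 = b := eq_of_le_of_not_lt hcb (hb.2 _ hc)
  exact h₁.symm.trans h₂

/-- An atom below a minimal upper bound of a set of atoms belongs to that set. -/
theorem IsSimplicialPoset.mem_of_isAtom_of_le {Q : Type} [PartialOrder Q] [OrderBot Q]
    [Fintype Q] (hQ : IsSimplicialPoset Q) {A : Set Q} (hA : ∀ a ∈ A, IsAtom a) {z p : Q}
    (hz : z ∈ minUBset Q A) (hp : IsAtom p) (hpz : p ≤ z) : p ∈ A := by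
  by_contra hpA
  obtain ⟨m, ⟨e⟩⟩ := hQ z
  let p' : Set.Iic z := ⟨p, hpz⟩
  let c := e.symm (Finset.univ \ e p')
  have hc : ∀ v ∈ A, v ≤ c.1 := fun v hv => by
    let v' : Set.Iic z := ⟨v, hz.1 v hv⟩
    let d := e.symm (e v' ∩ e p')
    have hdv : d ≤ v' := (e.symm_apply_le).2 Finset.inter_subset_left
    have hdp : d ≤ p' := (e.symm_apply_le).2 Finset.inter_subset_right
    have hd : d.1 = ⊥ := by
      by_contra hd
      have h₁ : d.1 = v := ((hA v hv).le_iff.1 hdv).resolve_left hd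
      have h₂ : d.1 = p := (hp.le_iff.1 hdp).resolve_left hd
      exact hpA (h₂ ▸ h₁ ▸ hv)
    have hdisj : e v' ∩ e p' = ∅ := by
      have : d ≤ e.symm ∅ := show d.1 ≤ _ from hd ▸ bot_le
      exact Finset.subset_empty.1 (e.symm.le_iff_le.1 this)
    refine (e.le_symm_apply (x := v')).2 ?_
    exact Finset.subset_sdiff.2 ⟨Finset.subset_univ _, Finset.disjoint_iff_inter_eq_empty.2 hdisj⟩
  have hcz : c.1 = z := eq_of_le_of_not_lt c.2 (hz.2 _ hc)
  have hpc : p' ≤ c := hpz.trans hcz.ge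
  have hempty : e p' = ∅ := by
    have h := (e.le_symm_apply).1 hpc
    exact Finset.disjoint_self_iff_empty _ |>.1 (Finset.subset_sdiff.1 h).2
  refine hp.1 (le_bot_iff.1 ?_)
  exact show p' ≤ ⟨⊥, bot_le⟩ from e.le_iff_le.1 (hempty ▸ Finset.empty_subset _)

theorem IsSimplicialPoset.filter_le_eq {Q : Type} [PartialOrder Q] [OrderBot Q] [Fintype Q]
    (hQ : IsSimplicialPoset Q) {k : ℕ} {v : Fin k → Q} (hv : AtomEnum Q k v)
    {U : Finset (Fin k)} {z : Q} (hz : z ∈ minUBset Q (v '' (U : Set (Fin k)))) :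
    (Finset.univ.filter fun i => v i ≤ z) = U := by
  ext i
  simp only [Finset.mem_filter, Finset.mem_univ, true_and]
  refine ⟨fun hi => ?_, fun hi => hz.1 _ ⟨i, hi, rfl⟩⟩
  obtain ⟨j, hj, hji⟩ := hQ.mem_of_isAtom_of_le
    (by rintro _ ⟨j, -, rfl⟩; exact (hv.2 _).2 ⟨j, rfl⟩) hz ((hv.2 _).2 ⟨i, rfl⟩) hi
  exact hv.1 hji ▸ hj

theorem AtomEnum.prank_atom {Q : Type} [PartialOrder Q] [OrderBot Q] [Fintype Q]
    {k : ℕ} {v : Fin k → Q} (hv : AtomEnum Q k v) (i : Fin k) : prank Q k v (v i) = 1 := by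
  refine Finset.card_eq_one.2 ⟨i, ?_⟩
  ext j
  have hi : IsAtom (v i) := (hv.2 _).2 ⟨i, rfl⟩
  have hj : IsAtom (v j) := (hv.2 _).2 ⟨j, rfl⟩
  simp only [Finset.mem_filter, Finset.mem_univ, true_and, Finset.mem_singleton]
  exact ⟨fun h => hv.1 ((hi.le_iff.1 h).resolve_left hj.1), fun h => h ▸ le_rfl⟩

theorem tvar_mul_tvar_mem_faceIdeal {F : Type} [Field F] {Q : Type} [PartialOrder Q] [OrderBot Q]
    [Fintype Q] {a b : Q} (ha : a ≠ ⊥) (hb : b ≠ ⊥) (hab : ∀ w, a ≤ w → ¬ b ≤ w) :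
    tvar F Q a * tvar F Q b ∈ faceIdeal F Q := by
  have hempty : (Set.toFinite (minUB Q a b)).toFinset = ∅ := by
    ext w
    simp only [Set.Finite.mem_toFinset, Finset.notMem_empty, iff_false]
    exact fun hw => hab w hw.1 hw.2.1
  have hgen : fgen F Q ⟨a, ha⟩ ⟨b, hb⟩ = tvar F Q a * tvar F Q b := by
    rw [fgen, hempty, Finset.sum_empty, mul_zero, sub_zero, tvar, tvar, dif_neg ha, dif_neg hb]
  exact hgen ▸ Ideal.subset_span ⟨(⟨a, ha⟩, ⟨b, hb⟩), rfl⟩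

/-- Lemma 2.6(2): for distinct `z₁, z₂ ∈ [U]` with `z₁ ≤ x`,
`g_{z₁,z₂} := t̃_{z₁} t̃_{z₂} + t̃_{z₂} ∏_{i ∈ U} t̃_i ∈ I_P`. -/
theorem statement1
    (hP : IsSimplicialPoset P) (hy : AtomEnum P n y)
    (x : P) (r : ℕ) (hr : 1 ≤ r)
    (hx : ∀ i : Fin n, y i ≤ x ↔ (i : ℕ) < r)
    (U : Finset (Fin n)) (hU : ∀ i ∈ U, (i : ℕ) < r) (hU2 : 2 ≤ U.card)
    (z₁ z₂ : P) (hz₁ : z₁ ∈ minUBset P (y '' (U : Set (Fin n))))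
    (hz₂ : z₂ ∈ minUBset P (y '' (U : Set (Fin n))))
    (hne : z₁ ≠ z₂) (hz₁x : z₁ ≤ x) :
    ttil K P n y x z₁ * ttil K P n y x z₂ +
      ttil K P n y x z₂ * ∏ i ∈ U, ttil K P n y x (y i) ∈ faceIdeal K P := by
  have hno : ∀ w, z₁ ≤ w → ¬ z₂ ≤ w := fun w h₁ h₂ =>
    hne (hP.eq_of_mem_minUBset_of_le hz₁ hz₂ h₁ h₂)
  have hbot₁ : z₁ ≠ ⊥ := fun h => hno z₂ (h ▸ bot_le) le_rfl
  have hbot₂ : z₂ ≠ ⊥ := fun h => hno z₁ le_rfl (h ▸ bot_le)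
  have hfilter := hP.filter_le_eq hy hz₁
  have hprank : 2 ≤ prank P n y z₁ := by rwa [prank, hfilter]
  have ht₁ : ttil K P n y x z₁ = tvar K P z₁ - ∏ i ∈ U, tvar K P (y i) := by
    rw [ttil, if_pos ⟨hz₁x, hprank⟩, hfilter]
  have ht₂ : ttil K P n y x z₂ = tvar K P z₂ := if_neg fun h => hno x hz₁x h.1
  have hty : ∀ i, ttil K P n y x (y i) = tvar K P (y i) := fun i =>
    if_neg fun h => by simp [hy.prank_atom i] at h
  have hprod : ttil K P n y x z₁ * ttil K P n y x z₂ +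
      ttil K P n y x z₂ * ∏ i ∈ U, ttil K P n y x (y i) = tvar K P z₁ * tvar K P z₂ := by
    simp only [hty, ht₁, ht₂]
    ring
  exact hprod ▸ tvar_mul_tvar_mem_faceIdeal hbot₁ hbot₂ hno

end
end

section
/- Let x ∈ P have rank r ≥ 1 with {i : y_i ≤ x} = {1,…,r}. Then *E_x is a *essential extension of S_x: for every nonzero Z^n-homogeneous element α ∈ *E_x one has Sα ∩ S_x ≠ 0, where S_x is identified with the submodule S·1_x of *E_x. -/
open scoped Classical
open MvPolynomial

noncomputable section

variable (K : Type) [Field K]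
variable (P : Type) [Fintype P] [PartialOrder P] [OrderBot P]

variable (n : ℕ) (y : Fin n → P)

variable {K P n y}

set_option linter.unusedSectionVars false

theorem gx_smul_def (x : P) (s : FaceS K P) (g : Gx K P n y x) :
    s • g = theta K P n y x s * g := rfl

/-- The exponents whose monomial lies in the image of `theta`. -/
def thetaExponents (K : Type) [Field K] {P : Type} [Fintype P] [PartialOrder P] [OrderBot P]
    {n : ℕ} (y : Fin n → P) (x : P) : AddSubmonoid (EIdx P n y x) where
  carrier := {q | ∃ s, theta K P n y x s = AddMonoidAlgebra.single q 1}
  zero_mem' := ⟨1, map_one _⟩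
  add_mem' := by
    rintro p q ⟨s, hs⟩ ⟨t, ht⟩
    exact ⟨s * t, by rw [map_mul, hs, ht, AddMonoidAlgebra.single_mul_single, one_mul]⟩

theorem mem_thetaExponents {x : P} {q : EIdx P n y x} :
    q ∈ thetaExponents K y x ↔ ∃ s, theta K P n y x s = AddMonoidAlgebra.single q 1 := Iff.rfl

theorem dvec_atom (hy : AtomEnum P n y) (x : P) (i : BelowIx P n y x) :
    dvec P n y x (y i.1) = Finsupp.single i 1 := by
  ext j
  have hiff : y j.1 ≤ y i.1 ↔ i = j := by
    refine ⟨fun h => ?_, fun h => h ▸ le_rfl⟩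
    have hi : IsAtom (y i.1) := (hy.2 _).2 ⟨_, rfl⟩
    have hj : IsAtom (y j.1) := (hy.2 _).2 ⟨_, rfl⟩
    exact Subtype.ext (hy.1 ((hi.le_iff_eq hj.1).1 h).symm)
  simp [dvec, Finsupp.single_apply, hiff]

theorem single_left_mem_thetaExponents (hy : AtomEnum P n y) (x : P) (i : BelowIx P n y x) :
    ((Finsupp.single i 1, 0) : EIdx P n y x) ∈ thetaExponents K y x := by
  refine mem_thetaExponents.2 ⟨X ⟨y i.1, ((hy.2 _).2 ⟨_, rfl⟩ : IsAtom (y i.1)).1⟩, ?_⟩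
  have h : ∃ j : Fin n, y j ≤ x ∧ y j = y i.1 := ⟨i.1, i.2, rfl⟩
  rw [theta, aeval_X, if_pos i.2, dif_pos h, add_zero, dvec_atom hy]

theorem nonneg_left_mem_thetaExponents (hy : AtomEnum P n y) (x : P)
    (a : BelowIx P n y x →₀ ℤ) (ha : 0 ≤ a) :
    ((a, 0) : EIdx P n y x) ∈ thetaExponents K y x := by
  have h : ((a, 0) : EIdx P n y x) =
      ∑ i, (a i).toNat • ((Finsupp.single i 1, 0) : EIdx P n y x) := by
    refine Prod.ext ?_ ?_
    · ext j
      simp [Prod.fst_sum, Finsupp.single_apply]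
      exact ha j
    · simp [Prod.snd_sum]
  rw [h]
  exact sum_mem fun i _ => nsmul_mem (single_left_mem_thetaExponents hy x i) _

theorem dvec_nonneg (x z : P) : 0 ≤ dvec P n y x z := by
  intro i
  simp only [dvec, Finsupp.equivFunOnFinite_symm_apply_apply, Finsupp.coe_zero, Pi.zero_apply]
  split_ifs <;> simp

theorem single_right_mem_thetaExponents (hy : AtomEnum P n y) (x : P) (w : Pmx P n y x) :
    ((0, Finsupp.single w 1) : EIdx P n y x) ∈ thetaExponents K y x := by
  obtain ⟨s, hs⟩ := mem_thetaExponents.1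
    (nonneg_left_mem_thetaExponents (K := K) hy x _ (dvec_nonneg x w.1))
  refine mem_thetaExponents.2 ⟨X ⟨w.1, w.2.1⟩ - if w.1 ≤ x then s else 0, ?_⟩
  rw [map_sub, apply_ite (theta K P n y x), hs, map_zero, theta, aeval_X, dif_neg w.2.2,
    add_sub_cancel_left]

theorem nonneg_mem_thetaExponents (hy : AtomEnum P n y) (x : P) (q : EIdx P n y x)
    (h1 : 0 ≤ q.1) (h2 : 0 ≤ q.2) : q ∈ thetaExponents K y x := by
  have h : q = (q.1, 0) +
      ∑ w, (q.2 w).toNat • ((0, Finsupp.single w 1) : EIdx P n y x) := by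
    refine Prod.ext ?_ ?_
    · simp [Prod.fst_sum]
    · ext j
      simp [Prod.snd_sum, Finsupp.single_apply]
      exact h2 j
  rw [h]
  exact add_mem (nonneg_left_mem_thetaExponents hy x _ h1)
    (sum_mem fun w _ => nsmul_mem (single_right_mem_thetaExponents hy x w) _)

/-- The elements of the big Laurent algebra supported on monomials which have a positive
exponent in the second factor; this turns out to be `Ux`. -/
def positiveSupport (K : Type) [Field K] {P : Type} [Fintype P] [PartialOrder P] [OrderBot P]
    {n : ℕ} (y : Fin n → P) (x : P) : Submodule K (Gx K P n y x) where
  carrier := {g | ∀ p : EIdx P n y x, p.2 ≤ 0 → g.coeff p = 0}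
  zero_mem' p _ := rfl
  add_mem' {f g} hf hg p hp := by
    rw [AddMonoidAlgebra.coeff_add, Finsupp.add_apply, hf p hp, hg p hp, add_zero]
  smul_mem' c g hg p hp := by
    rw [AddMonoidAlgebra.coeff_smul_apply, hg p hp, smul_zero]

theorem single_mul_mem_positiveSupport {x : P} {g : Gx K P n y x}
    (hg : g ∈ positiveSupport K y x) (q : EIdx P n y x) (hq : 0 ≤ q.2) (c : K) :
    AddMonoidAlgebra.single q c * g ∈ positiveSupport K y x := by
  intro p hp
  rw [AddMonoidAlgebra.coeff_single_mul_apply, hg, mul_zero]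
  exact add_nonpos (neg_nonpos.2 hq) hp

theorem smul_mem_positiveSupport {x : P} (s : FaceS K P) {g : Gx K P n y x}
    (hg : g ∈ positiveSupport K y x) : s • g ∈ positiveSupport K y x := by
  induction s using MvPolynomial.induction_on generalizing g with
  | C c =>
    rw [← mul_one (C c), ← MvPolynomial.smul_eq_C_mul, smul_assoc, one_smul]
    exact Submodule.smul_mem _ c hg
  | add s t hs ht => rw [add_smul]; exact add_mem (hs hg) (ht hg)
  | mul_X s z hs =>
    rw [mul_smul]
    refine hs ?_
    rw [gx_smul_def, theta, aeval_X, add_mul]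
    refine add_mem ?_ ?_
    · split_ifs
      · exact single_mul_mem_positiveSupport hg _ le_rfl 1
      · rw [zero_mul]; exact zero_mem _
    · split_ifs
      · rw [zero_mul]; exact zero_mem _
      · refine single_mul_mem_positiveSupport hg _ ?_ 1
        exact Finsupp.single_nonneg.2 zero_le_one

theorem Ux_le_positiveSupport {x : P} {g : Gx K P n y x} (hg : g ∈ Ux K P n y x) :
    g ∈ positiveSupport K y x := by
  induction hg using Submodule.span_induction with
  | mem g hg =>
    obtain ⟨p, ⟨w, hw⟩, rfl⟩ := hg
    intro q hq
    rw [AddMonoidAlgebra.coeff_single, Finsupp.single_apply, if_neg]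
    rintro rfl
    exact hw.not_ge (hq w)
  | zero => exact zero_mem _
  | add f g _ _ hf hg => exact add_mem hf hg
  | smul s g _ hg => exact smul_mem_positiveSupport s hg

theorem mem_of_forall_single_mem {x : P} (M : Submodule (FaceS K P) (Gx K P n y x))
    (g : Gx K P n y x)
    (h : ∀ p, g.coeff p ≠ 0 → (AddMonoidAlgebra.single p 1 : Gx K P n y x) ∈ M) : g ∈ M := by
  rw [← AddMonoidAlgebra.sum_coeff_single g]
  refine sum_mem fun p hp => ?_
  have hs : (AddMonoidAlgebra.single p (g.coeff p) : Gx K P n y x) =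
      g.coeff p • AddMonoidAlgebra.single p 1 := by
    rw [AddMonoidAlgebra.smul_single, smul_eq_mul, mul_one]
  rw [hs]
  exact Submodule.smul_of_tower_mem M _ (h p (Finsupp.mem_support_iff.1 hp))

theorem single_mem_Ux {x : P} (p : EIdx P n y x) (hp : ¬ p.2 ≤ 0) :
    (AddMonoidAlgebra.single p 1 : Gx K P n y x) ∈ Ux K P n y x := by
  refine Submodule.subset_span ⟨p, ?_, rfl⟩
  by_contra! h
  exact hp h

variable (K P n y)

/-- Proposition 2.4: `*E_x` is a *essential extension of `S_x`:
every nonzero homogeneous `α ∈ *E_x` satisfies `Sα ∩ S_x ≠ 0`, where `S_x` is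
identified with the submodule `S•1_x` of `*E_x`. -/
theorem statement3
    (hP : IsSimplicialPoset P) (hy : AtomEnum P n y)
    (x : P) (r : ℕ) (hr : 1 ≤ r)
    (hx : ∀ i : Fin n, y i ≤ x ↔ (i : ℕ) < r)
    (α : ExMod K P n y x) (hne : α ≠ 0)
    (aa : Fin n → ℤ) (hhom : α ∈ ExGrade K P n y x aa) :
    ∃ s : FaceS K P, s • α ≠ 0 ∧
      s • α ∈ Submodule.span (FaceS K P) {onex K P n y x} := by
  obtain ⟨g, rfl⟩ := Submodule.Quotient.mk_surjective _ α
  have hg : g ∉ Ux K P n y x := fun h => hne ((Submodule.Quotient.mk_eq_zero _).2 h)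
  obtain ⟨p₀, hp₀, hmin⟩ :=
    (g.coeff.support.filter fun p => p.2 ≤ 0).exists_minimalFor Prod.snd <| by
      by_contra h
      refine hg (mem_of_forall_single_mem _ g fun p hp => single_mem_Ux p fun hp2 => h ?_)
      exact ⟨p, Finset.mem_filter.2 ⟨Finsupp.mem_support_iff.2 hp, hp2⟩⟩
  rw [Finset.mem_filter, Finsupp.mem_support_iff] at hp₀
  obtain ⟨B, hB⟩ := (g.coeff.support.image Prod.fst).bddBelow
  -- Multiplication by `q` moves `p₀` to second exponent zero and makes first exponents nonnegative.
  obtain ⟨q, hq⟩ : ∃ q : EIdx P n y x, q = (B⁻, -p₀.2) := ⟨_, rfl⟩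
  obtain ⟨s, hs⟩ := mem_thetaExponents.1 <| nonneg_mem_thetaExponents (K := K) hy x q
    (hq ▸ negPart_nonneg B) (hq ▸ neg_nonneg.2 hp₀.2)
  refine ⟨s, ?_, ?_⟩
  · rw [← Submodule.Quotient.mk_smul, Ne, Submodule.Quotient.mk_eq_zero]
    intro h
    have h0 := Ux_le_positiveSupport h (q + p₀) (by simp [hq])
    rw [gx_smul_def, hs, AddMonoidAlgebra.coeff_single_mul_add, one_mul] at h0
    exact hp₀.1 h0
  · rw [← Submodule.Quotient.mk_smul]
    refine mem_of_forall_single_mem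
      ((Submodule.span (FaceS K P) {onex K P n y x}).comap (Ux K P n y x).mkQ) _ fun p hp => ?_
    rw [gx_smul_def, hs, AddMonoidAlgebra.coeff_single_mul_apply, one_mul] at hp
    obtain ⟨p', rfl⟩ : ∃ p', p = q + p' := ⟨-q + p, by abel⟩
    rw [neg_add_cancel_left] at hp
    rw [Submodule.mem_comap]
    by_cases h2 : (q + p').2 ≤ 0
    · have hle : p'.2 ≤ p₀.2 := by
        rw [hq, Prod.snd_add] at h2
        simpa using h2
      have heq : p'.2 = p₀.2 := le_antisymm hle <| hmin
        (Finset.mem_filter.2 ⟨Finsupp.mem_support_iff.2 hp, hle.trans hp₀.2⟩) hle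
      have h1 : B ≤ p'.1 := hB <| Finset.mem_coe.2 <|
        Finset.mem_image_of_mem _ (Finsupp.mem_support_iff.2 hp)
      obtain ⟨t, ht⟩ : ∃ t, theta K P n y x t = AddMonoidAlgebra.single (q + p') 1 := by
        refine mem_thetaExponents.1 <| nonneg_mem_thetaExponents hy x _ ?_ ?_
        · intro i
          have hneg : -B i ≤ B⁻ i := neg_le_negPart B i
          have hi : B i ≤ p'.1 i := h1 i
          rw [hq, Prod.fst_add, Finsupp.add_apply, Finsupp.zero_apply]
          linarith
        · simp [hq, heq]
      refine Submodule.mem_span_singleton.2 ⟨t, ?_⟩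
      have hm : mIdx P n y x 0 0 = 0 := by simp [mIdx]
      rw [onex, emono, ← Submodule.Quotient.mk_smul, gx_smul_def, hm, ht,
        AddMonoidAlgebra.single_mul_single, add_zero, one_mul]
      rfl
    · rw [Submodule.mkQ_apply, (Submodule.Quotient.mk_eq_zero _).2 (single_mem_Ux _ h2)]
      exact zero_mem _

end
end

section
/- Let x ∈ P have rank r ≥ 1 with {i : y_i ≤ x} = {1,…,r}. For every Z^n-graded prime ideal p of S with p ⊇ p_x, the first graded Ext module *Ext^1_S(S/p, *E_x) vanishes. -/
open scoped Classical
open MvPolynomial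

noncomputable section

variable (K : Type) [Field K]
variable (P : Type) [Fintype P] [PartialOrder P] [OrderBot P]

variable (n : ℕ) (y : Fin n → P)

/-- A `ℤⁿ`-grading on an `S`-module `M`, compatible with the `ℤⁿ`-grading of `S`:
an object of the category `*Mod S`. -/
structure GradedSMod (M : Type) [AddCommGroup M] [Module (FaceS K P) M] where
  grade : (Fin n → ℤ) → AddSubgroup M
  internal : DirectSum.IsInternal grade
  smul_le : ∀ (d aa : Fin n → ℤ) (s : FaceS K P), s ∈ Sgrade K P n y d →
    ∀ m ∈ grade aa, s • m ∈ grade (aa + d)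

/-- A `ℤⁿ`-graded ideal of `S`. -/
def IsGradedIdeal (I : Ideal (FaceS K P)) : Prop :=
  ∀ f ∈ I, ∀ d : Fin n → ℤ, weightedHomogeneousComponent (tdeg P n y) d f ∈ I

section Helpers

variable {K P n y}

theorem GradedSMod.exists_proj {M : Type} [AddCommGroup M] [Module (FaceS K P) M]
    (gM : GradedSMod K P n y M) :
    ∃ pr : (Fin n → ℤ) → M →+ M, (∀ c m, pr c m ∈ gM.grade c) ∧
      (∀ c, ∀ m ∈ gM.grade c, pr c m = m) ∧
      (∀ c d, ∀ m ∈ gM.grade c, c ≠ d → pr d m = 0) ∧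
      ∀ m, ∃ s : Finset (Fin n → ℤ), ∀ t, s ⊆ t → ∑ c ∈ t, pr c m = m := by
  let := gM.internal.chooseDecomposition
  refine ⟨fun c => ⟨⟨fun m => (DirectSum.decompose gM.grade m c : M), by simp⟩, by simp⟩,
    fun c m => SetLike.coe_mem _, fun c m hm => DirectSum.decompose_of_mem_same _ hm,
    fun c d m hm h => DirectSum.decompose_of_mem_ne _ hm h, fun m => ?_⟩
  refine ⟨(DirectSum.decompose gM.grade m).support, fun t ht => ?_⟩
  conv_rhs => rw [← DirectSum.sum_support_decompose gM.grade m]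
  symm
  refine Finset.sum_subset ht fun c _ hc => ?_
  simpa using hc

theorem weightedHomogeneousComponent_mem_Sgrade (d : Fin n → ℤ) (s : FaceS K P) :
    weightedHomogeneousComponent (tdeg P n y) d s ∈ Sgrade K P n y d :=
  weightedHomogeneousComponent_mem _ _ _

/-- The homogeneous components of an element annihilated by a graded ideal are annihilated
by that ideal. -/
theorem smul_proj_eq_zero {M : Type} [AddCommGroup M] [Module (FaceS K P) M]
    (gM : GradedSMod K P n y M) {pr : (Fin n → ℤ) → M →+ M}
    (hmem : ∀ c m, pr c m ∈ gM.grade c) (hsame : ∀ c, ∀ m ∈ gM.grade c, pr c m = m)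
    (hne : ∀ c d, ∀ m ∈ gM.grade c, c ≠ d → pr d m = 0)
    (hsum : ∀ m, ∃ s : Finset (Fin n → ℤ), ∀ t, s ⊆ t → ∑ c ∈ t, pr c m = m)
    {p : Ideal (FaceS K P)} (hgr : IsGradedIdeal K P n y p) {m : M}
    (hm : ∀ s ∈ p, s • m = 0) (c : Fin n → ℤ) : ∀ s ∈ p, s • pr c m = 0 := by
  have key : ∀ d, ∀ s ∈ Sgrade K P n y d, s • pr c m = pr (c + d) (s • m) := by
    intro d s hs
    obtain ⟨S, hS⟩ := hsum m
    have h1 := hS (insert c S) (Finset.subset_insert _ _)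
    conv_rhs => rw [← h1, Finset.smul_sum, map_sum]
    rw [Finset.sum_eq_single c]
    · rw [hsame _ _ (gM.smul_le d c s hs _ (hmem c m))]
    · intro b _ hb
      exact hne (b + d) _ _ (gM.smul_le d b s hs _ (hmem b m)) fun h => hb (add_right_cancel h)
    · simp
  intro s hs
  rw [← finsum_weightedHomogeneousComponent (tdeg P n y) s,
    finsum_eq_sum _ (weightedHomogeneousComponent_finsupp s), Finset.sum_smul]
  refine Finset.sum_eq_zero fun d _ => ?_
  rw [key d _ (weightedHomogeneousComponent_mem_Sgrade d s), hm _ (hgr s hs d), map_zero]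

/-- The degree-zero component of a lift of `1` is again a lift of `1`. -/
theorem map_proj_zero_eq_one {M : Type} [AddCommGroup M] [Module (FaceS K P) M]
    (gM : GradedSMod K P n y M) {pr : (Fin n → ℤ) → M →+ M}
    (hmem : ∀ c m, pr c m ∈ gM.grade c)
    (hsum : ∀ m, ∃ s : Finset (Fin n → ℤ), ∀ t, s ⊆ t → ∑ c ∈ t, pr c m = m)
    {p : Ideal (FaceS K P)} (hgr : IsGradedIdeal K P n y p)
    (π : M →ₗ[FaceS K P] (FaceS K P ⧸ p))
    (hπgr : ∀ c, ∀ m ∈ gM.grade c,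
      π m ∈ (Sgrade K P n y c).map (Ideal.Quotient.mk p).toAddMonoidHom)
    {m : M} (hm : π m = 1) : π (pr 0 m) = 1 := by
  choose f hf hfe using fun c => hπgr c _ (hmem c m)
  obtain ⟨S, hS⟩ := hsum m
  have h1 := hS (insert 0 S) (Finset.subset_insert _ _)
  rw [← h1, map_sum] at hm
  have h2 : (∑ c ∈ insert 0 S, f c) - 1 ∈ p := by
    rw [← Ideal.Quotient.eq_zero_iff_mem, map_sub, map_one, map_sum, sub_eq_zero, ← hm]
    exact Finset.sum_congr rfl fun c _ => hfe c
  have h3 := hgr _ h2 0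
  rw [map_sub, map_sum, Finset.sum_eq_single 0,
    IsWeightedHomogeneous.weightedHomogeneousComponent_same (hf 0),
    IsWeightedHomogeneous.weightedHomogeneousComponent_same (isWeightedHomogeneous_one K _)] at h3
  · rw [← Ideal.Quotient.eq_zero_iff_mem, map_sub, map_one, sub_eq_zero] at h3
    rw [← h3]
    exact (hfe 0).symm
  · intro b _ hb
    exact IsWeightedHomogeneous.weightedHomogeneousComponent_ne 0 (hf b) hb.symm
  · simp

variable (K P n y) in
theorem iSup_ExGrade (x : P) : ⨆ c, ExGrade K P n y x c = ⊤ := by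
  rw [eq_top_iff]
  rintro e -
  obtain ⟨g, rfl⟩ := Submodule.Quotient.mk_surjective _ e
  induction g using AddMonoidAlgebra.induction_linear with
  | zero => exact zero_mem _
  | add f g hf hg => rw [Submodule.Quotient.mk_add]; exact add_mem hf hg
  | single q c =>
    have : (AddMonoidAlgebra.single q c : Gx K P n y x) = c • AddMonoidAlgebra.single q 1 := by
      simp
    rw [this]
    change c • (Submodule.Quotient.mk (AddMonoidAlgebra.single q 1) : ExMod K P n y x) ∈ _
    exact Submodule.smul_mem _ _
      (Submodule.mem_iSup_of_mem (gdeg P n y x q) (Submodule.subset_span ⟨q, rfl, rfl⟩))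

/-- A graded injection out of `*E_x` reflects degrees. -/
theorem mem_ExGrade_of_map_mem {M : Type} [AddCommGroup M] [Module (FaceS K P) M]
    (gM : GradedSMod K P n y M) {pr : (Fin n → ℤ) → M →+ M}
    (hsame : ∀ c, ∀ m ∈ gM.grade c, pr c m = m)
    (hne : ∀ c d, ∀ m ∈ gM.grade c, c ≠ d → pr d m = 0)
    {x : P} {aa : Fin n → ℤ} (ι : ExMod K P n y x →ₗ[FaceS K P] M) (hι : Function.Injective ι)
    (hιgr : ∀ c, ∀ e ∈ ExGrade K P n y x c, ι e ∈ gM.grade (c - aa))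
    {c : Fin n → ℤ} {e : ExMod K P n y x} (he : ι e ∈ gM.grade c) :
    e ∈ ExGrade K P n y x (c + aa) := by
  have h : ∃ e' ∈ ExGrade K P n y x (c + aa), pr c (ι e) = ι e' := by
    have : e ∈ ⨆ c, ExGrade K P n y x c := iSup_ExGrade K P n y x ▸ Submodule.mem_top
    clear he
    induction this using Submodule.iSup_induction' with
    | mem d e he =>
      by_cases hd : d = c + aa
      · subst hd
        refine ⟨e, he, hsame _ _ ?_⟩
        simpa using hιgr _ e he
      · refine ⟨0, zero_mem _, ?_⟩
        rw [map_zero]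
        refine hne (d - aa) _ _ (hιgr d e he) fun h => hd ?_
        rw [← h, sub_add_cancel]
    | zero => exact ⟨0, zero_mem _, by simp⟩
    | add a b _ _ ha hb =>
      obtain ⟨a', ha', ha⟩ := ha
      obtain ⟨b', hb', hb⟩ := hb
      exact ⟨a' + b', add_mem ha' hb', by simp [ha, hb]⟩
  obtain ⟨e', he', h⟩ := h
  rw [hsame _ _ he] at h
  exact hι h ▸ he'

/-- An extension of `S/p` by `*E_x` splits in the graded category as soon as some lift of `1`
is annihilated by `p`. -/
theorem exists_graded_retraction {x : P}
    {p : Ideal (FaceS K P)} (hgr : IsGradedIdeal K P n y p)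
    (aa : Fin n → ℤ)
    {M : Type} [AddCommGroup M] [Module (FaceS K P) M]
    (gM : GradedSMod K P n y M)
    (ι : ExMod K P n y x →ₗ[FaceS K P] M)
    (π : M →ₗ[FaceS K P] (FaceS K P ⧸ p))
    (hι : Function.Injective ι)
    (hexact : LinearMap.range ι = LinearMap.ker π)
    (hιgr : ∀ c, ∀ e ∈ ExGrade K P n y x c, ι e ∈ gM.grade (c - aa))
    (hπgr : ∀ c, ∀ m ∈ gM.grade c,
      π m ∈ (Sgrade K P n y c).map (Ideal.Quotient.mk p).toAddMonoidHom)
    {m : M} (hm1 : π m = 1) (hm : ∀ s ∈ p, s • m = 0) :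
    ∃ ρ : M →ₗ[FaceS K P] ExMod K P n y x,
      ρ.comp ι = LinearMap.id ∧
      ∀ c, ∀ m ∈ gM.grade c, ρ m ∈ ExGrade K P n y x (c + aa) := by
  obtain ⟨pr, hmem, hsame, hne, hsum⟩ := gM.exists_proj
  have hm0 := smul_proj_eq_zero gM hmem hsame hne hsum hgr hm 0
  have hm01 := map_proj_zero_eq_one gM hmem hsum hgr π hπgr hm1
  have hmg := hmem 0 m
  generalize pr 0 m = m₀ at hm0 hm01 hmg
  let σ : (FaceS K P ⧸ p) →ₗ[FaceS K P] M :=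
    Submodule.liftQ p (LinearMap.toSpanSingleton (FaceS K P) M m₀) fun s hs => by
      simpa using hm0 s hs
  have hσ : ∀ s, σ (Ideal.Quotient.mk p s) = s • m₀ := fun s => rfl
  have hπσ : ∀ q, π (σ q) = q := by
    intro q
    obtain ⟨s, rfl⟩ := Ideal.Quotient.mk_surjective q
    rw [hσ, map_smul, hm01]
    change Ideal.Quotient.mk p (s * 1) = _
    rw [mul_one]
  have hr : ∀ m', (LinearMap.id - σ.comp π : M →ₗ[FaceS K P] M) m' ∈ LinearMap.range ι := by
    intro m'
    rw [hexact, LinearMap.mem_ker]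
    simp [hπσ]
  let ρ : M →ₗ[FaceS K P] ExMod K P n y x :=
    (LinearEquiv.ofInjective ι hι).symm.toLinearMap.comp
      (LinearMap.codRestrict (LinearMap.range ι) (LinearMap.id - σ.comp π) hr)
  have hρ : ∀ m', ι (ρ m') = m' - σ (π m') := fun m' =>
    congrArg Subtype.val ((LinearEquiv.ofInjective ι hι).apply_symm_apply
      (LinearMap.codRestrict (LinearMap.range ι) (LinearMap.id - σ.comp π) hr m'))
  refine ⟨ρ, ?_, ?_⟩
  · refine LinearMap.ext fun e => hι ?_
    have : π (ι e) = 0 := by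
      rw [← LinearMap.mem_ker, ← hexact]
      exact ⟨e, rfl⟩
    simp [hρ, this]
  · intro c m' hm'
    refine mem_ExGrade_of_map_mem gM hsame hne ι hι hιgr ?_
    rw [hρ]
    obtain ⟨s, hs, hse⟩ := hπgr c m' hm'
    refine sub_mem hm' ?_
    rw [← hse]
    have := gM.smul_le c 0 s hs m₀ hmg
    rw [zero_add] at this
    exact this

/-- `∏_{y_i ≤ z} t_i` if `z ≤ x`, and `0` otherwise: the image of `t_z` in `S_x`. -/
def redvar (K : Type) [Field K] {P : Type} [Fintype P] [PartialOrder P] [OrderBot P]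
    {n : ℕ} (y : Fin n → P) (x z : P) : FaceS K P :=
  if z ≤ x then ∏ i ∈ Finset.univ.filter fun i : Fin n => y i ≤ z, tvar K P (y i) else 0

theorem AtomEnum.ne_bot (hy : AtomEnum P n y) (i : Fin n) : y i ≠ ⊥ :=
  ((hy.2 (y i)).2 ⟨i, rfl⟩).1

theorem AtomEnum.le_iff (hy : AtomEnum P n y) (i j : Fin n) : y i ≤ y j ↔ i = j := by
  refine ⟨fun h => hy.1 ?_, fun h => h ▸ le_rfl⟩
  exact (((hy.2 (y j)).2 ⟨j, rfl⟩).le_iff.1 h).resolve_left (hy.ne_bot i)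

theorem theta_tvar_atom (hy : AtomEnum P n y) {x : P} (i : Fin n) (hi : y i ≤ x) :
    theta K P n y x (tvar K P (y i)) =
      AddMonoidAlgebra.single (Finsupp.single ⟨i, hi⟩ 1, 0) 1 := by
  rw [tvar, dif_neg (hy.ne_bot i), theta, aeval_X, if_pos hi, dif_pos ⟨i, hi, rfl⟩, add_zero]
  congr 2
  ext j
  simp [dvec, hy.le_iff, Finsupp.single_apply, Subtype.ext_iff, eq_comm]

theorem theta_redvar (hy : AtomEnum P n y) (x z : P) :
    theta K P n y x (redvar K y x z) =
      if z ≤ x then AddMonoidAlgebra.single (dvec P n y x z, 0) 1 else 0 := by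
  unfold redvar
  split_ifs with hz
  · have h : ∀ s : Finset (Fin n), (∀ i ∈ s, y i ≤ x) →
        theta K P n y x (∏ i ∈ s, tvar K P (y i)) = AddMonoidAlgebra.single
          (Finsupp.equivFunOnFinite.symm fun i : BelowIx P n y x => if i.1 ∈ s then 1 else 0, 0)
          1 := by
      intro s
      induction s using Finset.induction_on with
      | empty =>
        intro _
        rw [Finset.prod_empty, map_one, AddMonoidAlgebra.one_def]
        congr 1
        refine Prod.ext ?_ rfl
        ext j
        simp
      | insert a s ha ih =>
        intro hs
        rw [Finset.prod_insert ha, map_mul, ih fun i hi => hs i (Finset.mem_insert_of_mem hi),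
          theta_tvar_atom hy a (hs a (Finset.mem_insert_self _ _)),
          AddMonoidAlgebra.single_mul_single, mul_one]
        congr 1
        refine Prod.ext ?_ (by simp)
        ext j
        by_cases hja : j.1 = a
        · have : j = ⟨a, hs a (Finset.mem_insert_self _ _)⟩ := Subtype.ext hja
          subst this
          simp [ha]
        · have : (⟨a, hs a (Finset.mem_insert_self _ _)⟩ : BelowIx P n y x) ≠ j :=
            fun h => hja (h ▸ rfl)
          simp [hja, Finsupp.single_eq_of_ne' this]
    rw [h _ fun i hi => (Finset.mem_filter.1 hi).2.trans hz]
    simp [dvec]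
  · exact map_zero _

/-- The transformed variable `t_z - ∏_{y_i ≤ z} t_i` acts on `*E_x` through the second factor. -/
theorem theta_X_sub_redvar (hy : AtomEnum P n y) (x : P) (w : Pmx P n y x) :
    theta K P n y x (X ⟨w.1, w.2.1⟩ - redvar K y x w.1) =
      AddMonoidAlgebra.single (0, Finsupp.single w 1) 1 := by
  rw [map_sub, theta_redvar hy, theta, aeval_X, dif_neg w.2.2]
  exact add_sub_cancel_left _ _

theorem coeff_mul_single_ne_zero {x : P} {g : Gx K P n y x} {a q : EIdx P n y x} {c : K}
    (h : (AddMonoidAlgebra.single a c * g).coeff q ≠ 0) : g.coeff (q - a) ≠ 0 := by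
  intro h0
  apply h
  rw [AddMonoidAlgebra.coeff_single_mul_apply, neg_add_eq_sub, h0, mul_zero]

/-- The submodule `Ux` consists of the Laurent polynomials all of whose monomials have a positive
exponent in the second factor. -/
theorem mem_Ux_iff {x : P} {g : Gx K P n y x} :
    g ∈ Ux K P n y x ↔ ∀ q, g.coeff q ≠ 0 → ∃ w, 0 < q.2 w := by
  constructor
  · intro hg
    have hsingle : ∀ (a : EIdx P n y x) (c : K) (g : Gx K P n y x), (∀ w, 0 ≤ a.2 w) →
        (∀ q, g.coeff q ≠ 0 → ∃ w, 0 < q.2 w) →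
        ∀ q, (AddMonoidAlgebra.single a c * g).coeff q ≠ 0 → ∃ w, 0 < q.2 w := by
      intro a c g ha hg q hq
      obtain ⟨w, hw⟩ := hg _ (coeff_mul_single_ne_zero hq)
      refine ⟨w, ?_⟩
      have := ha w
      simp only [Prod.snd_sub, Finsupp.sub_apply] at hw
      lia
    have hadd : ∀ g h : Gx K P n y x, (∀ q, g.coeff q ≠ 0 → ∃ w, 0 < q.2 w) →
        (∀ q, h.coeff q ≠ 0 → ∃ w, 0 < q.2 w) →
        ∀ q, (g + h).coeff q ≠ 0 → ∃ w, 0 < q.2 w := by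
      intro g h hg hh q hq
      by_cases h0 : g.coeff q = 0
      · refine hh q fun h1 => hq ?_
        simp [h0, h1]
      · exact hg q h0
    have hzero : ∀ q, (0 : Gx K P n y x).coeff q ≠ 0 → ∃ w, 0 < q.2 w := by simp
    have htheta : ∀ (s : FaceS K P) (g : Gx K P n y x), (∀ q, g.coeff q ≠ 0 → ∃ w, 0 < q.2 w) →
        ∀ q, (theta K P n y x s * g).coeff q ≠ 0 → ∃ w, 0 < q.2 w := by
      intro s
      induction s using MvPolynomial.induction_on with
      | C a =>
        intro g hg
        have : theta K P n y x (C a) = AddMonoidAlgebra.single 0 a := by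
          rw [theta, aeval_C]
          rfl
        rw [this]
        exact hsingle _ _ _ (fun _ => le_rfl) hg
      | add s t hs ht =>
        intro g hg
        rw [map_add, add_mul]
        exact hadd _ _ (hs g hg) (ht g hg)
      | mul_X s z hs =>
        intro g hg
        rw [map_mul, mul_assoc]
        refine hs _ ?_
        rw [theta, aeval_X, add_mul]
        refine hadd _ _ ?_ ?_
        · split_ifs
          · exact hsingle _ _ _ (fun _ => le_rfl) hg
          · rw [zero_mul]
            exact hzero
        · split_ifs
          · rw [zero_mul]
            exact hzero
          · refine hsingle _ _ _ (fun w => ?_) hg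
            simp only [Finsupp.single_apply]
            split_ifs <;> simp
    induction hg using Submodule.span_induction with
    | mem g hg =>
      obtain ⟨p, hp, rfl⟩ := hg
      intro q hq
      have : p = q := by
        by_contra h
        exact hq (by simp [h])
      exact this ▸ hp
    | zero => exact hzero
    | add a b _ _ ha hb => exact hadd _ _ ha hb
    | smul s g _ hg => exact htheta s g hg
  · intro hg
    have : g = ∑ q ∈ g.coeff.support, (C (g.coeff q) : FaceS K P) •
        (AddMonoidAlgebra.single q 1 : Gx K P n y x) := by
      refine AddMonoidAlgebra.coeff_injective ?_
      conv_lhs => rw [← Finsupp.sum_single g.coeff]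
      rw [AddMonoidAlgebra.coeff_sum, Finsupp.sum]
      refine Finset.sum_congr rfl fun q _ => ?_
      change _ = (theta K P n y x (C (g.coeff q)) * AddMonoidAlgebra.single q 1).coeff
      rw [theta, aeval_C, ← Algebra.smul_def]
      simp
    rw [this]
    refine Submodule.sum_mem _ fun q hq => Submodule.smul_mem _ _ (Submodule.subset_span ?_)
    exact ⟨q, hg q (Finsupp.mem_support_iff.1 hq), rfl⟩

theorem mk_eq_zero_iff {x : P} {g : Gx K P n y x} :
    (Submodule.Quotient.mk g : ExMod K P n y x) = 0 ↔ ∀ q, g.coeff q ≠ 0 → ∃ w, 0 < q.2 w := by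
  rw [Submodule.Quotient.mk_eq_zero, mem_Ux_iff]

/-- The variables of the atoms below `x` act surjectively on `*E_x`. -/
theorem exists_tvar_smul_eq (hy : AtomEnum P n y) {x : P} {i : Fin n} (hi : y i ≤ x)
    (e : ExMod K P n y x) : ∃ e', tvar K P (y i) • e' = e := by
  obtain ⟨g, rfl⟩ := Submodule.Quotient.mk_surjective _ e
  refine ⟨Submodule.Quotient.mk
    (AddMonoidAlgebra.single (-Finsupp.single ⟨i, hi⟩ 1, 0) 1 * g), ?_⟩
  rw [← Submodule.Quotient.mk_smul]
  congr 1
  change theta K P n y x (tvar K P (y i)) * _ = g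
  rw [theta_tvar_atom hy i hi, ← mul_assoc, AddMonoidAlgebra.single_mul_single]
  simp only [Prod.mk_add_mk, add_neg_cancel, add_zero, mul_one]
  exact one_mul g

/-- The variables of the atoms below `x` act injectively on `*E_x`. -/
theorem eq_zero_of_tvar_smul_eq_zero (hy : AtomEnum P n y) {x : P} {i : Fin n} (hi : y i ≤ x)
    {e : ExMod K P n y x} (he : tvar K P (y i) • e = 0) : e = 0 := by
  obtain ⟨g, rfl⟩ := Submodule.Quotient.mk_surjective _ e
  rw [← Submodule.Quotient.mk_smul, mk_eq_zero_iff] at he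
  rw [mk_eq_zero_iff]
  intro q hq
  obtain ⟨w, hw⟩ := he ((Finsupp.single ⟨i, hi⟩ 1, 0) + q) (by
    change (theta K P n y x (tvar K P (y i)) * g).coeff _ ≠ 0
    rw [theta_tvar_atom hy i hi, AddMonoidAlgebra.coeff_single_mul_apply,
      neg_add_cancel_left, one_mul]
    exact hq)
  exact ⟨w, by simpa using hw⟩

/-- Each transformed variable acts surjectively on the part of `*E_x` killed by a set of other
transformed variables. -/
theorem exists_preimage_of_smul_eq_zero (hy : AtomEnum P n y) {x : P} {F : Finset (Pmx P n y x)}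
    {w : Pmx P n y x} (hw : w ∉ F) (e : ExMod K P n y x)
    (he : ∀ z ∈ F, (X ⟨z.1, z.2.1⟩ - redvar K y x z.1 : FaceS K P) • e = 0) :
    ∃ e' : ExMod K P n y x, (X ⟨w.1, w.2.1⟩ - redvar K y x w.1 : FaceS K P) • e' = e ∧
      ∀ z ∈ F, (X ⟨z.1, z.2.1⟩ - redvar K y x z.1 : FaceS K P) • e' = 0 := by
  have hact : ∀ (z : Pmx P n y x) (g : Gx K P n y x),
      (X ⟨z.1, z.2.1⟩ - redvar K y x z.1 : FaceS K P) •
        (Submodule.Quotient.mk g : ExMod K P n y x) = Submodule.Quotient.mk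
          (AddMonoidAlgebra.single (0, Finsupp.single z 1) 1 * g) := by
    intro z g
    rw [← Submodule.Quotient.mk_smul, ← theta_X_sub_redvar hy]
    rfl
  obtain ⟨g, hgood, rfl⟩ : ∃ g : Gx K P n y x, (∀ q, g.coeff q ≠ 0 → ∀ w, q.2 w ≤ 0) ∧
      Submodule.Quotient.mk g = e := by
    obtain ⟨g, rfl⟩ := Submodule.Quotient.mk_surjective _ e
    refine ⟨.ofCoeff (g.coeff.filter fun q => ∀ w, q.2 w ≤ 0), ?_, ?_⟩
    · intro q hq
      by_contra h
      exact hq (Finsupp.filter_apply_neg _ _ h)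
    · rw [← sub_eq_zero, ← Submodule.Quotient.mk_sub, mk_eq_zero_iff]
      intro q hq
      by_contra! h
      apply hq
      rw [AddMonoidAlgebra.coeff_sub, Finsupp.sub_apply, AddMonoidAlgebra.coeff_ofCoeff,
        Finsupp.filter_apply_pos _ _ h, sub_self]
  refine ⟨Submodule.Quotient.mk (AddMonoidAlgebra.single (0, -Finsupp.single w 1) 1 * g), ?_, ?_⟩
  · rw [hact, ← mul_assoc, AddMonoidAlgebra.single_mul_single]
    simp only [Prod.mk_add_mk, add_neg_cancel, add_zero, mul_one]
    rw [show ((0, 0) : EIdx P n y x) = 0 from rfl, ← AddMonoidAlgebra.one_def, one_mul]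
  · intro z hz
    have hz' := he z hz
    rw [hact, mk_eq_zero_iff] at hz' ⊢
    rw [mul_left_comm]
    intro q hq
    have h1 := coeff_mul_single_ne_zero hq
    have h2 := hgood _ (coeff_mul_single_ne_zero h1)
    obtain ⟨v, hv⟩ := hz' _ h1
    have h2v := h2 v
    have hzw : z ≠ w := fun h => hw (h ▸ hz)
    refine ⟨z, ?_⟩
    simp only [Prod.snd_sub, Finsupp.sub_apply, sub_neg_eq_add, Finsupp.add_apply] at hv h2v ⊢
    by_cases hvz : z = v
    · subst hvz
      rw [Finsupp.single_eq_of_ne hzw] at hv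
      lia
    · exfalso
      rw [Finsupp.single_eq_of_ne' hvz] at h2v
      lia

theorem tvar_sub_prod_mem_pIdeal (hP : IsSimplicialPoset P) (hy : AtomEnum P n y) {x z : P}
    (hz : z ≤ x) :
    tvar K P z - ∏ i ∈ Finset.univ.filter fun i : Fin n => y i ≤ z, tvar K P (y i) ∈
      pIdeal K P x := by
  obtain ⟨m, ⟨e⟩⟩ := hP x
  have hle : ∀ (w : P) (hw : w ≤ x) (A : Finset (Fin m)),
      w ≤ (e.symm A : P) ↔ e ⟨w, hw⟩ ⊆ A := fun w hw A =>
    e.le_symm_apply (x := ⟨w, hw⟩)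
  have hge : ∀ (w : P) (hw : w ≤ x) (A : Finset (Fin m)),
      (e.symm A : P) ≤ w ↔ A ⊆ e ⟨w, hw⟩ := fun w hw A =>
    e.symm_apply_le (x := ⟨w, hw⟩)
  have hx : ∀ A, (e.symm A : P) ≤ x := fun A => (e.symm A).2
  have hbot : ∀ A, (e.symm A : P) = ⊥ ↔ A = ∅ := by
    intro A
    rw [← le_bot_iff, hge ⊥ bot_le, ← Finset.subset_empty]
    have : e ⟨⊥, bot_le⟩ = ∅ := by
      rw [← Finset.subset_empty, ← hle ⊥ bot_le]
      exact bot_le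
    rw [this]
  have hinf : ∀ (w : P) (A B : Finset (Fin m)), Disjoint A B → w ≤ e.symm A → w ≤ e.symm B →
      w = ⊥ := by
    intro w A B hAB h1 h2
    have hw := h1.trans (hx A)
    rw [hle w hw] at h1 h2
    have h3 : w ≤ e.symm ∅ := by
      rw [hle w hw, ← (Finset.disjoint_iff_inter_eq_empty.1 hAB)]
      exact Finset.subset_inter h1 h2
    rwa [(hbot ∅).2 rfl, le_bot_iff] at h3
  have hatom : ∀ k, IsAtom (e.symm {k} : P) := by
    intro k
    refine ⟨fun h => by simpa using (hbot _).1 h, fun w hw => ?_⟩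
    have hwx := hw.le.trans (hx _)
    have h1 := hw.le
    rw [hle w hwx, Finset.subset_singleton_iff] at h1
    rcases h1 with h1 | h1
    · have h2 : w ≤ e.symm ∅ := by rw [hle w hwx, h1]
      rwa [(hbot ∅).2 rfl, le_bot_iff] at h2
    · exact absurd ((hge w hwx _).2 h1.ge) hw.not_ge
  have key : ∀ Z : Finset (Fin m), tvar K P (e.symm Z) -
      ∏ i ∈ Finset.univ.filter fun i : Fin n => y i ≤ e.symm Z, tvar K P (y i) ∈
        pIdeal K P x := by
    intro Z
    induction Z using Finset.induction_on with
    | empty =>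
      rw [(hbot ∅).2 rfl, Finset.filter_false_of_mem fun i _ h => hy.ne_bot i (le_bot_iff.1 h)]
      simp [tvar]
    | insert k Z hk ih =>
      by_cases hZ : Z = ∅
      · subst hZ
        obtain ⟨i, hi⟩ := (hy.2 _).1 (hatom k)
        rw [insert_empty_eq, ← hi]
        simp only [hy.le_iff, Finset.filter_eq', Finset.mem_univ, if_true, Finset.prod_singleton,
          sub_self]
        exact zero_mem _
      have ha : (e.symm {k} : P) ≠ ⊥ := (hatom k).1
      have hb : (e.symm Z : P) ≠ ⊥ := mt (hbot Z).1 hZ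
      have hd : Disjoint {k} Z := by simpa using hk
      have hf : fgen K P ⟨_, ha⟩ ⟨_, hb⟩ ∈ pIdeal K P x :=
        Ideal.mem_sup_right (Ideal.subset_span ⟨(⟨_, ha⟩, ⟨_, hb⟩), rfl⟩)
      have hmeet : pmeet P (e.symm {k} : P) (e.symm Z) = ⊥ := by
        unfold pmeet
        split_ifs with h
        · exact hinf _ _ _ hd h.choose_spec.1 h.choose_spec.2.1
        · rfl
      have hac : (e.symm {k} : P) ≤ e.symm (insert k Z) := by
        exact e.symm.monotone (Finset.singleton_subset_iff.2 (Finset.mem_insert_self _ _))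
      have hbc : (e.symm Z : P) ≤ e.symm (insert k Z) := by
        exact e.symm.monotone (Finset.subset_insert _ _)
      have hsup : ∀ w ≤ x, (e.symm {k} : P) ≤ w → (e.symm Z : P) ≤ w →
          (e.symm (insert k Z) : P) ≤ w := by
        intro w hw h1 h2
        rw [hge w hw] at h1 h2 ⊢
        exact Finset.insert_subset (h1 (Finset.mem_singleton_self k)) h2
      have hc : (e.symm (insert k Z) : P) ∈
          (Set.toFinite (minUB P (e.symm {k} : P) (e.symm Z))).toFinset := by
        rw [Set.Finite.mem_toFinset]
        exact ⟨hac, hbc, fun w h1 h2 h3 =>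
          (hsup w (h3.le.trans (hx _)) h1 h2).not_gt h3⟩
      have hsum : ∑ z ∈ (Set.toFinite (minUB P (e.symm {k} : P) (e.symm Z))).toFinset,
          tvar K P z - tvar K P (e.symm (insert k Z)) ∈ pIdeal K P x := by
        rw [← Finset.add_sum_erase _ _ hc, add_sub_cancel_left]
        refine sum_mem fun w hw => ?_
        rw [Finset.mem_erase, Set.Finite.mem_toFinset] at hw
        obtain ⟨hwc, hw1, hw2, hw3⟩ := hw
        have hwx : ¬ w ≤ x := fun h =>
          hw3 _ hac hbc (lt_of_le_of_ne (hsup w h hw1 hw2) (Ne.symm hwc))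
        have hw0 : w ≠ ⊥ := fun h => hwx (h ▸ bot_le)
        rw [tvar, dif_neg hw0]
        exact Ideal.mem_sup_left (Ideal.subset_span ⟨⟨w, hw0⟩, hwx, rfl⟩)
      have hprod : ∏ i ∈ Finset.univ.filter fun i : Fin n => y i ≤ e.symm (insert k Z),
          tvar K P (y i) = tvar K P (e.symm {k}) *
            ∏ i ∈ Finset.univ.filter fun i : Fin n => y i ≤ e.symm Z, tvar K P (y i) := by
        obtain ⟨j, hj⟩ := (hy.2 _).1 (hatom k)
        have : (Finset.univ.filter fun i : Fin n => y i ≤ e.symm (insert k Z)) =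
            insert j (Finset.univ.filter fun i : Fin n => y i ≤ e.symm Z) := by
          ext i
          simp only [Finset.mem_filter, Finset.mem_univ, true_and, Finset.mem_insert]
          constructor
          · intro h
            have hix := h.trans (hx _)
            by_cases hik : k ∈ e ⟨y i, hix⟩
            · left
              have h1 : (e.symm {k} : P) ≤ y i := (hge _ hix _).2 (by simpa using hik)
              rw [← hj, hy.le_iff] at h1
              exact h1.symm
            · right
              rw [hle _ hix] at h ⊢
              exact (Finset.subset_insert_iff_of_notMem hik).1 h
          · rintro (rfl | h)
            · exact hj ▸ hac
            · exact h.trans hbc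
        rw [this, Finset.prod_insert, hj]
        intro h
        rw [Finset.mem_filter] at h
        exact hy.ne_bot j (hinf _ _ _ hd hj.le h.2)
      rw [hprod]
      have hf' : tvar K P (e.symm {k}) * tvar K P (e.symm Z) -
          ∑ z ∈ (Set.toFinite (minUB P (e.symm {k} : P) (e.symm Z))).toFinset, tvar K P z ∈
            pIdeal K P x := by
        rw [fgen, hmeet] at hf
        simpa [tvar, ha, hb] using hf
      have := sub_mem (Ideal.mul_mem_left _ (tvar K P (e.symm {k})) ih) (add_mem hf' hsum)
      convert this using 1
      ring
  simpa using key (e ⟨z, hz⟩)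

theorem X_sub_redvar_mem_pIdeal (hP : IsSimplicialPoset P) (hy : AtomEnum P n y) (x : P)
    (z : Pstar P) : X z - redvar K y x z.1 ∈ pIdeal K P x := by
  unfold redvar
  split_ifs with hz
  · have := tvar_sub_prod_mem_pIdeal (K := K) hP hy hz
    rwa [tvar, dif_neg z.2] at this
  · rw [sub_zero]
    exact Ideal.mem_sup_left (Ideal.subset_span ⟨z, hz, rfl⟩)

/-- Modulo the elements `t_z - ∏_{y_i ≤ z} t_i`, a homogeneous polynomial is a scalar multiple of
the monomial of its degree in the variables of the atoms below `x`. -/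
theorem exists_sub_C_mul_prod_mem {x : P} {J : Ideal (FaceS K P)}
    (hJ : ∀ z : Pstar P, X z - redvar K y x z.1 ∈ J) {d : Fin n → ℤ} {s : FaceS K P}
    (hs : s ∈ Sgrade K P n y d) :
    ∃ c : K, s - C c * ∏ i ∈ Finset.univ.filter fun i : Fin n => y i ≤ x,
      tvar K P (y i) ^ (d i).toNat ∈ J := by
  have hnn : ∀ (u : Pstar P →₀ ℕ) i, 0 ≤ Finsupp.weight (tdeg P n y) u i := by
    intro u i
    rw [Finsupp.weight_apply, Finsupp.sum, Finset.sum_apply]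
    refine Finset.sum_nonneg fun z _ => ?_
    simp only [Pi.smul_apply, tdeg]
    split_ifs <;> simp
  have hmon : ∀ u : Pstar P →₀ ℕ, ∃ c : K,
      monomial u 1 - C c * ∏ i ∈ Finset.univ.filter fun i : Fin n => y i ≤ x,
        tvar K P (y i) ^ (Finsupp.weight (tdeg P n y) u i).toNat ∈ J := by
    have hzero : ∃ c : K,
      monomial (0 : Pstar P →₀ ℕ) 1 - C c * ∏ i ∈ Finset.univ.filter fun i : Fin n => y i ≤ x,
        tvar K P (y i) ^ (Finsupp.weight (tdeg P n y) (0 : Pstar P →₀ ℕ) i).toNat ∈ J :=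
      ⟨1, by simp⟩
    have hadd : ∀ u v : Pstar P →₀ ℕ,
      (∃ c : K, monomial u 1 - C c * ∏ i ∈ Finset.univ.filter fun i : Fin n => y i ≤ x,
        tvar K P (y i) ^ (Finsupp.weight (tdeg P n y) u i).toNat ∈ J) →
      (∃ c : K, monomial v 1 - C c * ∏ i ∈ Finset.univ.filter fun i : Fin n => y i ≤ x,
        tvar K P (y i) ^ (Finsupp.weight (tdeg P n y) v i).toNat ∈ J) →
      ∃ c : K, monomial (u + v) 1 - C c * ∏ i ∈ Finset.univ.filter fun i : Fin n => y i ≤ x,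
        tvar K P (y i) ^ (Finsupp.weight (tdeg P n y) (u + v) i).toNat ∈ J := by
      rintro u v ⟨c, hc⟩ ⟨c', hc'⟩
      refine ⟨c * c', ?_⟩
      have h1 : (monomial (u + v) 1 : FaceS K P) = monomial u 1 * monomial v 1 := by simp
      simp only [map_add, Pi.add_apply, Int.toNat_add (hnn u _) (hnn v _), pow_add,
        Finset.prod_mul_distrib, h1, map_mul]
      rw [← Ideal.Quotient.mk_eq_mk_iff_sub_mem] at hc hc' ⊢
      rw [map_mul, hc, hc', ← map_mul]
      congr 1
      ring
    intro u
    induction u using Finsupp.induction_linear with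
    | zero => exact hzero
    | add u v hu hv => exact hadd u v hu hv
    | single z k =>
      induction k with
      | zero => simpa using hzero
      | succ k ih =>
        rw [Finsupp.single_add]
        refine hadd _ _ ih ⟨if z.1 ≤ x then 1 else 0, ?_⟩
        have hz := hJ z
        unfold redvar at hz
        convert hz using 1
        refine congrArg (X z - ·) ?_
        split_ifs with hzx
        · simp only [Finsupp.weight_single, one_smul, map_one, one_mul, tdeg]
          rw [← Finset.prod_subset
            (Finset.monotone_filter_right _ fun i _ (h : y i ≤ z.1) => h.trans hzx)]
          · refine Finset.prod_congr rfl fun i hi => ?_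
            rw [if_pos (Finset.mem_filter.1 hi).2, Int.toNat_one, pow_one]
          · intro i _ hi
            rw [if_neg fun h => hi (Finset.mem_filter.2 ⟨Finset.mem_univ i, h⟩), Int.toNat_zero,
              pow_zero]
        · rw [map_zero, zero_mul]
  choose c hc using hmon
  refine ⟨∑ u ∈ s.support, coeff u s * c u, ?_⟩
  have h1 : s = ∑ u ∈ s.support, C (coeff u s) * monomial u 1 := by
    conv_lhs => rw [← support_sum_monomial_coeff s]
    exact Finset.sum_congr rfl fun u _ => by rw [C_mul_monomial, mul_one]
  rw [map_sum, Finset.sum_mul]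
  nth_rewrite 1 [h1]
  rw [← Finset.sum_sub_distrib]
  refine sum_mem fun u hu => ?_
  have hw : Finsupp.weight (tdeg P n y) u = d := hs (mem_support_iff.1 hu)
  rw [map_mul, mul_assoc, ← mul_sub, ← hw]
  exact Ideal.mul_mem_left _ _ (hc u)

/-- A graded prime containing no variable of an atom below `x` is contained in any ideal it
contains that has all `t_z - ∏_{y_i ≤ z} t_i` among its elements. -/
theorem le_of_tvar_notMem {x : P} {J p : Ideal (FaceS K P)} [hpr : p.IsPrime]
    (hgr : IsGradedIdeal K P n y p) (hJ : ∀ z : Pstar P, X z - redvar K y x z.1 ∈ J)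
    (hJp : J ≤ p) (hp : ∀ i, y i ≤ x → tvar K P (y i) ∉ p) : p ≤ J := by
  intro s hs
  rw [← finsum_weightedHomogeneousComponent (tdeg P n y) s,
    finsum_eq_sum _ (weightedHomogeneousComponent_finsupp s)]
  refine sum_mem fun d _ => ?_
  obtain ⟨c, hc⟩ := exists_sub_C_mul_prod_mem hJ (weightedHomogeneousComponent_mem_Sgrade d s)
  have h1 := sub_mem (hgr s hs d) (hJp hc)
  rw [sub_sub_cancel] at h1
  have h2 : c = 0 := by
    by_contra h0
    rcases hpr.mem_or_mem h1 with h | h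
    · exact hpr.ne_top (Ideal.eq_top_of_isUnit_mem _ h ((isUnit_iff_ne_zero.2 h0).map C))
    · obtain ⟨i, hi, h⟩ := (Ideal.IsPrime.prod_mem_iff (hp := hpr)).1 h
      exact hp i (Finset.mem_filter.1 hi).2 (hpr.mem_of_pow_mem _ h)
  rwa [h2, map_zero, zero_mul, sub_zero] at hc

/-- A lift of `1` can be corrected to one annihilated by `p`. -/
theorem exists_lift_one_smul_eq_zero (hP : IsSimplicialPoset P) (hy : AtomEnum P n y)
    {x : P} {p : Ideal (FaceS K P)} [p.IsPrime]
    (hgr : IsGradedIdeal K P n y p) (hpx : pIdeal K P x ≤ p)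
    {M : Type} [AddCommGroup M] [Module (FaceS K P) M]
    (ι : ExMod K P n y x →ₗ[FaceS K P] M)
    (π : M →ₗ[FaceS K P] (FaceS K P ⧸ p))
    (hι : Function.Injective ι) (hπ : Function.Surjective π)
    (hexact : LinearMap.range ι = LinearMap.ker π) :
    ∃ m, π m = 1 ∧ ∀ s ∈ p, s • m = 0 := by
  obtain ⟨m₀, hm₀⟩ := hπ 1
  have hπι : ∀ e, π (ι e) = 0 := fun e => by
    rw [← LinearMap.mem_ker, ← hexact]
    exact ⟨e, rfl⟩
  have hlift : ∀ m, π m = 1 → ∀ s ∈ p, ∃ e, ι e = s • m := by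
    intro m hm s hs
    rw [← LinearMap.mem_range, hexact, LinearMap.mem_ker, map_smul, hm]
    change Ideal.Quotient.mk p (s * 1) = 0
    rw [mul_one]
    exact Ideal.Quotient.eq_zero_iff_mem.2 hs
  by_cases hp : ∃ i, y i ≤ x ∧ tvar K P (y i) ∈ p
  · obtain ⟨i, hi, hip⟩ := hp
    obtain ⟨e, he⟩ := hlift m₀ hm₀ _ hip
    obtain ⟨e', rfl⟩ := exists_tvar_smul_eq hy hi e
    have hm1 : π (m₀ - ι e') = 1 := by rw [map_sub, hπι, sub_zero, hm₀]
    refine ⟨m₀ - ι e', hm1, fun s hs => ?_⟩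
    obtain ⟨e'', he''⟩ := hlift _ hm1 s hs
    rw [← he'', eq_zero_of_tvar_smul_eq_zero hy hi (e := e''), map_zero]
    apply hι
    rw [map_smul, he'', smul_comm, smul_sub, ← map_smul, he, sub_self, smul_zero, map_zero]
  · push Not at hp
    have hF : ∀ F : Finset (Pmx P n y x), ∃ m, π m = 1 ∧
        ∀ z ∈ F, (X ⟨z.1, z.2.1⟩ - redvar K y x z.1 : FaceS K P) • m = 0 := by
      intro F
      induction F using Finset.induction_on with
      | empty => exact ⟨m₀, hm₀, by simp⟩
      | insert w F hw ih =>
        obtain ⟨m, hm, hmF⟩ := ih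
        obtain ⟨e, he⟩ := hlift m hm _ (hpx (X_sub_redvar_mem_pIdeal hP hy x ⟨w.1, w.2.1⟩))
        obtain ⟨e', he', heF⟩ := exists_preimage_of_smul_eq_zero hy hw e fun z hz => hι (by
          rw [map_smul, he, smul_comm, hmF z hz, smul_zero, map_zero])
        have hm' : π (m - ι e') = 1 := by rw [map_sub, hπι, sub_zero, hm]
        refine ⟨m - ι e', hm', ?_⟩
        intro z hz
        rw [smul_sub, ← map_smul]
        rcases Finset.mem_insert.1 hz with rfl | hz
        · rw [he', he, sub_self]
        · rw [heF z hz, hmF z hz, map_zero, sub_zero]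
    obtain ⟨m, hm, hmF⟩ := hF Finset.univ
    refine ⟨m, hm, fun s hs => ?_⟩
    let J := Ideal.span (Set.range fun z : Pstar P => (X z - redvar K y x z.1 : FaceS K P))
    have hgen : ∀ z : Pstar P, X z - redvar K y x z.1 ∈ J := fun z =>
      Ideal.subset_span (Set.mem_range_self z)
    have hsJ : s ∈ J := by
      refine le_of_tvar_notMem hgr hgen ?_ hp hs
      rw [Ideal.span_le]
      rintro _ ⟨z, rfl⟩
      exact hpx (X_sub_redvar_mem_pIdeal hP hy x z)
    have hJ : J ≤ LinearMap.ker (LinearMap.toSpanSingleton (FaceS K P) M m) := by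
      rw [Ideal.span_le]
      rintro _ ⟨z, rfl⟩
      rw [SetLike.mem_coe, LinearMap.mem_ker, LinearMap.toSpanSingleton_apply]
      beta_reduce
      by_cases h : ∃ i : Fin n, y i ≤ x ∧ y i = z.1
      · obtain ⟨i, hi, hiz⟩ := h
        have : redvar K y x z.1 = X z := by
          rw [← hiz, redvar, if_pos hi]
          simp only [hy.le_iff, Finset.filter_eq', Finset.mem_univ, if_true, Finset.prod_singleton]
          rw [tvar, dif_neg (hy.ne_bot i)]
          congr 1
          exact Subtype.ext hiz
        rw [this, sub_self, zero_smul]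
      · exact hmF ⟨z.1, z.2, h⟩ (Finset.mem_univ _)
    exact hJ hsJ

end Helpers

/-- from the proof of Theorem 2.5: for every `ℤⁿ`-graded prime
`p ⊇ p_x`, `*Ext¹_S(S/p, *E_x) = 0`.  Equivalently (for every degree `aa` of the
graded `Ext`-module): every extension `0 → *E_x(aa) → M → S/p → 0` in the
category of `ℤⁿ`-graded `S`-modules splits by a degree preserving retraction. -/
theorem statement5
    (hP : IsSimplicialPoset P) (hy : AtomEnum P n y)
    (x : P) (r : ℕ) (hr : 1 ≤ r)
    (hx : ∀ i : Fin n, y i ≤ x ↔ (i : ℕ) < r)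
    (p : Ideal (FaceS K P)) (hpr : p.IsPrime)
    (hgr : IsGradedIdeal K P n y p) (hpx : pIdeal K P x ≤ p)
    (aa : Fin n → ℤ)
    (M : Type) [AddCommGroup M] [Module (FaceS K P) M]
    (gM : GradedSMod K P n y M)
    (ι : ExMod K P n y x →ₗ[FaceS K P] M)
    (π : M →ₗ[FaceS K P] (FaceS K P ⧸ p))
    (hι : Function.Injective ι) (hπ : Function.Surjective π)
    (hexact : LinearMap.range ι = LinearMap.ker π)
    (hιgr : ∀ c, ∀ e ∈ ExGrade K P n y x c, ι e ∈ gM.grade (c - aa))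
    (hπgr : ∀ c, ∀ m ∈ gM.grade c,
      π m ∈ (Sgrade K P n y c).map (Ideal.Quotient.mk p).toAddMonoidHom) :
    ∃ ρ : M →ₗ[FaceS K P] ExMod K P n y x,
      ρ.comp ι = LinearMap.id ∧
      ∀ c, ∀ m ∈ gM.grade c, ρ m ∈ ExGrade K P n y x (c + aa) := by
  obtain ⟨m, hm1, hm⟩ := exists_lift_one_smul_eq_zero hP hy hgr hpx ι π hι hπ hexact
  exact exists_graded_retraction hgr aa gM ι π hι hexact hιgr hπgr hm1 hm

end
end
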